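/- For each integer k ≥ 1, let λ_k > 0 be a real number such that E[min(X_k, k)]/k = Pr(X_k ≤ k−1), where X_k is a Poisson random variable with mean λ_k. Then Pr(X_k ≤ k−1) = 1 − √(log k / k) + o(√(log k / k)) as k → ∞; equivalently, (1 − Pr(X_k ≤ k−1))/√(log k / k) → 1. Here log denotes the natural logarithm. -/

import Mathlib

open Real Filter Finset

/-- The probability that a Poisson variable with mean `t` takes the value `m`. -/
noncomputable def poissonWeight (t : ℝ) (m : ℕ) : ℝ :=
  Real.exp (-t) * t ^ m / m.factorial

/-- The probability that a Poisson variable with mean `t` is at least `k`. -/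
noncomputable def poissonTail (t : ℝ) (k : ℕ) : ℝ :=
  1 - ∑ m ∈ Finset.range k, poissonWeight t m

lemma poissonWeight_pos {t : ℝ} (ht : 0 < t) (m : ℕ) : 0 < poissonWeight t m := by
  unfold poissonWeight
  positivity

lemma succ_mul_poissonWeight_succ (t : ℝ) (m : ℕ) :
    ((m : ℝ) + 1) * poissonWeight t (m + 1) = t * poissonWeight t m := by
  simp only [poissonWeight, Nat.factorial_succ]
  push_cast
  field_simp
  ring

lemma hasSum_poissonWeight (t : ℝ) : HasSum (poissonWeight t) 1 := by
  convert! (NormedSpace.expSeries_div_hasSum_exp t).mul_left (Real.exp (-t)) using 1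
  · ext m
    simp [poissonWeight, mul_div_assoc]
  · simp [← Real.exp_eq_exp_ℝ, ← Real.exp_add]

lemma hasSum_poissonTail (t : ℝ) (k : ℕ) :
    HasSum (fun m => poissonWeight t (m + k)) (poissonTail t k) :=
  (hasSum_nat_add_iff' k).2 (hasSum_poissonWeight t)

lemma sum_mul_poissonWeight (t : ℝ) (k : ℕ) :
    ∑ m ∈ Finset.range k, (m : ℝ) * poissonWeight t m
      = t * ∑ m ∈ Finset.range k, poissonWeight t m - k * poissonWeight t k := by
  induction k with
  | zero => simp
  | succ k ih =>
    rw [Finset.sum_range_succ, Finset.sum_range_succ, ih]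
    push_cast
    rw [succ_mul_poissonWeight_succ]
    ring

lemma hasSum_min_mul_poissonWeight (t : ℝ) (k : ℕ) :
    HasSum (fun m : ℕ => (↑(min m k) : ℝ) * poissonWeight t m)
      (t * (1 - poissonTail t k) - k * poissonWeight t k + k * poissonTail t k) := by
  rw [← hasSum_nat_add_iff' k]
  convert! (hasSum_poissonTail t k).mul_left (k : ℝ) using 1
  · ext m
    simp
  · have h : ∑ m ∈ Finset.range k, (↑(min m k) : ℝ) * poissonWeight t m
        = ∑ m ∈ Finset.range k, (m : ℝ) * poissonWeight t m :=
      Finset.sum_congr rfl fun m hm => by rw [min_eq_left (Finset.mem_range.1 hm).le]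
    rw [h, sum_mul_poissonWeight, poissonTail]
    ring

lemma mul_poissonTail_eq_of_balance {t : ℝ} {k : ℕ} (hk : 1 ≤ k)
    (h : (∑' m : ℕ, (↑(min m k) : ℝ) * poissonWeight t m) / k
      = ∑ m ∈ Finset.range k, poissonWeight t m) :
    k * poissonTail t k = (k - t) * (1 - poissonTail t k) + k * poissonWeight t k := by
  have hk0 : (k : ℝ) ≠ 0 := by positivity
  rw [(hasSum_min_mul_poissonWeight t k).tsum_eq, div_eq_iff hk0] at h
  have h2 : ∑ m ∈ Finset.range k, poissonWeight t m = 1 - poissonTail t k := by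
    simp [poissonTail]
  rw [h2] at h
  linarith

lemma poissonTail_nonneg {t : ℝ} (ht : 0 < t) (k : ℕ) : 0 ≤ poissonTail t k :=
  (hasSum_poissonTail t k).nonneg fun _ => (poissonWeight_pos ht _).le

lemma poissonTail_le_one {t : ℝ} (ht : 0 < t) (k : ℕ) : poissonTail t k ≤ 1 :=
  sub_le_self _ (Finset.sum_nonneg fun _ _ => (poissonWeight_pos ht _).le)

lemma hasDerivAt_poissonTail_succ (t : ℝ) (k : ℕ) :
    HasDerivAt (fun t => poissonTail t (k + 1)) (poissonWeight t k) t := by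
  induction k with
  | zero =>
    simpa [poissonTail, poissonWeight] using ((hasDerivAt_neg t).exp).const_sub 1
  | succ k ih =>
    have h : (fun t => poissonTail t (k + 1 + 1))
        = fun t => poissonTail t (k + 1) - poissonWeight t (k + 1) := by
      ext t
      simp only [poissonTail]
      rw [Finset.sum_range_succ _ (k + 1)]
      ring
    rw [h]
    convert! ih.sub (((hasDerivAt_neg t).exp.mul (hasDerivAt_pow (k + 1) t)).div_const
      ((k + 1).factorial : ℝ)) using 1
    simp only [poissonWeight, Nat.factorial_succ, Nat.add_sub_cancel]
    push_cast
    field_simp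
    ring

lemma poissonTail_mono {s t : ℝ} (hs : 0 < s) (hst : s ≤ t) (k : ℕ) :
    poissonTail s k ≤ poissonTail t k := by
  cases k with
  | zero => simp [poissonTail]
  | succ k =>
    refine monotoneOn_of_hasDerivWithinAt_nonneg (f' := fun t => poissonWeight t k)
      (convex_Ioi (0 : ℝ))
      (fun x _ => (hasDerivAt_poissonTail_succ x k).continuousAt.continuousWithinAt)
      (fun x _ => (hasDerivAt_poissonTail_succ x k).hasDerivWithinAt) (fun x hx => ?_)
      hs (hs.trans_le hst) hst
    rw [interior_Ioi] at hx
    exact (poissonWeight_pos hx k).le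

lemma div_exp_one_pow_eq_exp {n : ℕ} (hn : n ≠ 0) :
    ((n : ℝ) / Real.exp 1) ^ n = Real.exp (n * Real.log n - n) := by
  have hn0 : (0 : ℝ) < n := by positivity
  rw [← mul_sub_one, Real.exp_nat_mul, Real.exp_sub, Real.exp_log hn0]

lemma factorial_le_stirling {n : ℕ} (hn : n ≠ 0) :
    (n.factorial : ℝ) ≤ Real.exp 1 * √n * ((n : ℝ) / Real.exp 1) ^ n := by
  obtain ⟨m, rfl⟩ := Nat.exists_eq_succ_of_ne_zero hn
  have h := Stirling.stirlingSeq'_antitone (Nat.zero_le m)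
  simp only [Function.comp_apply, Nat.succ_eq_add_one, zero_add, Stirling.stirlingSeq_one] at h
  rw [Stirling.stirlingSeq, div_le_div_iff₀ (by positivity) (by positivity),
    Real.sqrt_mul (by norm_num)] at h
  refine le_of_mul_le_mul_right (h.trans_eq ?_) (show 0 < √(2 : ℝ) by positivity)
  simp only [Nat.succ_eq_add_one]
  ring

lemma exp_neg_mul_pow_eq {t : ℝ} (ht : 0 < t) (n : ℕ) :
    Real.exp (-t) * t ^ n = Real.exp (n * Real.log t - t) := by
  rw [sub_eq_neg_add, Real.exp_add, Real.exp_nat_mul, Real.exp_log ht]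

lemma le_poissonWeight {t : ℝ} (ht : 0 < t) {n : ℕ} (hn : n ≠ 0) :
    Real.exp (n - t + n * Real.log (t / n)) / (Real.exp 1 * √n) ≤ poissonWeight t n := by
  have hn0 : (0 : ℝ) < n := by positivity
  have h := factorial_le_stirling hn
  rw [div_exp_one_pow_eq_exp hn] at h
  rw [poissonWeight, exp_neg_mul_pow_eq ht, div_le_div_iff₀ (by positivity) (by positivity),
    Real.log_div ht.ne' hn0.ne']
  refine (mul_le_mul_of_nonneg_left h (Real.exp_pos _).le).trans_eq ?_
  have : Real.exp (n * Real.log t - t) = Real.exp (n - t + n * (Real.log t - Real.log n))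
      * Real.exp (n * Real.log n - n) := by
    rw [← Real.exp_add]
    ring_nf
  rw [this]
  ring

lemma poissonWeight_le_inv_sqrt {t : ℝ} (ht : 0 < t) {n : ℕ} (hn : n ≠ 0) :
    poissonWeight t n ≤ 1 / √n := by
  have hn0 : (0 : ℝ) < n := by positivity
  have h : √n * Real.exp (n * Real.log n - n) ≤ n.factorial := by
    rw [← div_exp_one_pow_eq_exp hn]
    refine le_trans ?_ (Stirling.le_factorial_stirling n)
    gcongr
    nlinarith [Real.pi_gt_three]
  rw [poissonWeight, exp_neg_mul_pow_eq ht, div_le_div_iff₀ (by positivity) (by positivity),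
    one_mul]
  refine le_trans ?_ h
  rw [mul_comm]
  gcongr ?_ * Real.exp ?_
  have := Real.log_le_sub_one_of_pos (div_pos ht hn0)
  rw [Real.log_div ht.ne' hn0.ne', le_sub_iff_add_le, le_div_iff₀ hn0] at this
  linarith

lemma log_one_sub_le {x : ℝ} (hx : 0 ≤ x) (hx1 : x < 1) :
    Real.log (1 - x) ≤ -x - x ^ 2 / 2 := by
  have h := sum_le_hasSum (Finset.range 2) (fun i _ => by positivity)
    (Real.hasSum_pow_div_log_of_abs_lt_one (x := x) (by rwa [abs_of_nonneg hx]))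
  norm_num [Finset.sum_range_succ] at h
  linarith

lemma le_log_one_sub {x : ℝ} (hx : 0 ≤ x) (hx1 : x ≤ 1 / 2) :
    -x - x ^ 2 / 2 - 2 * x ^ 3 ≤ Real.log (1 - x) := by
  have h := Real.abs_log_sub_add_sum_range_le (x := x) (by rw [abs_of_nonneg hx]; linarith) 2
  norm_num [Finset.sum_range_succ, abs_of_nonneg hx] at h
  have h2 : x ^ 3 / (1 - x) ≤ 2 * x ^ 3 := by
    rw [div_le_iff₀ (by linarith)]
    nlinarith [pow_nonneg hx 3]
  linarith [(abs_le.1 h).1]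

lemma poissonTail_le_exp {t : ℝ} (ht : 0 < t) {k : ℕ} (hk : k ≠ 0) (htk : t ≤ k) :
    poissonTail t k ≤ Real.exp (-((k - t) ^ 2 / (2 * k))) := by
  have hk0 : (0 : ℝ) < k := by positivity
  have h1 : 1 ≤ (k : ℝ) / t := (one_le_div ht).2 htk
  have hs : HasSum (fun m => Real.exp (k - t) * poissonWeight k m) (Real.exp (k - t)) := by
    simpa using (hasSum_poissonWeight k).mul_left (Real.exp (k - t))
  have hw (m : ℕ) : Real.exp (k - t) * poissonWeight k m = poissonWeight t m * (k / t) ^ m := by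
    simp only [poissonWeight, div_pow, Real.exp_sub, Real.exp_neg]
    field_simp
  have hc : (k / t) ^ k * poissonTail t k ≤ Real.exp (k - t) := by
    refine hasSum_le_of_sum_le ((hasSum_poissonTail t k).mul_left _) fun F => ?_
    have hp (m : ℕ) : 0 ≤ Real.exp (k - t) * poissonWeight k m :=
      mul_nonneg (Real.exp_pos _).le (poissonWeight_pos hk0 m).le
    refine le_trans (Finset.sum_le_sum (g := fun m => Real.exp (k - t) * poissonWeight k (m + k))
      fun m _ => ?_) ?_
    · rw [hw, mul_comm]
      exact mul_le_mul_of_nonneg_left (pow_le_pow_right₀ h1 (Nat.le_add_left k m))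
        (poissonWeight_pos ht _).le
    · simpa using sum_le_hasSum (F.map (addRightEmbedding k)) (fun m _ => hp m) hs
  have he : (k / t) ^ k = Real.exp (-(k * Real.log (t / k))) := by
    rw [← mul_neg, ← Real.log_inv, inv_div, Real.exp_nat_mul, Real.exp_log (by positivity)]
  have hlog := log_one_sub_le (x := (k - t) / k) (div_nonneg (by linarith) hk0.le)
    ((div_lt_one hk0).2 (by linarith))
  have hx : 1 - (k - t) / k = t / k := by field_simp; ring
  rw [hx] at hlog
  have hm : k * Real.log (t / k) ≤ -(k - t) - (k - t) ^ 2 / (2 * k) := by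
    refine (mul_le_mul_of_nonneg_left hlog hk0.le).trans_eq ?_
    field_simp
  rw [he, ← le_div_iff₀' (Real.exp_pos _), ← Real.exp_sub] at hc
  exact hc.trans (Real.exp_le_exp.2 (by linarith))

lemma antitone_poissonWeight_add {t : ℝ} (ht : 0 < t) {k : ℕ} (htk : t ≤ k) :
    Antitone fun j => poissonWeight t (k + j) := by
  refine antitone_nat_of_succ_le fun j => ?_
  have hj : (0 : ℝ) < ↑(k + j) + 1 := by positivity
  refine le_of_mul_le_mul_left ?_ hj
  rw [← add_assoc, succ_mul_poissonWeight_succ]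
  have hle : t ≤ ↑(k + j) + 1 := by
    push_cast
    linarith [(Nat.cast_nonneg j : (0 : ℝ) ≤ j)]
  exact mul_le_mul_of_nonneg_right hle (poissonWeight_pos ht _).le

lemma succ_mul_poissonWeight_le_poissonTail {t : ℝ} (ht : 0 < t) {k : ℕ} (htk : t ≤ k) (j : ℕ) :
    ((j : ℝ) + 1) * poissonWeight t (k + j) ≤ poissonTail t k := by
  refine le_trans ?_ (sum_le_hasSum (Finset.range (j + 1))
    (fun m _ => (poissonWeight_pos ht _).le) (hasSum_poissonTail t k))
  have h := Finset.card_nsmul_le_sum (Finset.range (j + 1)) (fun m => poissonWeight t (m + k))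
    (poissonWeight t (k + j)) fun m hm => by
      rw [add_comm m k]
      exact antitone_poissonWeight_add ht htk (Nat.lt_succ_iff.1 (Finset.mem_range.1 hm))
  simpa using h

lemma exp_div_four_le_poissonTail {ε b : ℝ} (hε : 0 < ε) (hε1 : ε < 1) {k : ℕ} (hk : k ≠ 0)
    (hb : 2 ≤ ε * b) (hr : b ≤ ε / 8 * √k) :
    Real.exp (-((1 / 2 - ε / 4) * b ^ 2)) / 4 ≤ poissonTail (k - (1 - ε) * (b * √k)) k := by
  have hk0 : (0 : ℝ) < k := by positivity
  have hq : 0 < √(k : ℝ) := by positivity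
  have hqq : √(k : ℝ) * √k = k := Real.mul_self_sqrt hk0.le
  have hb0 : 0 < b := by
    by_contra! h
    nlinarith
  set q := √(k : ℝ) with hqdef
  set t := (k : ℝ) - (1 - ε) * (b * q) with htdef
  have hsk : b * q ≤ ε / 8 * k := by
    rw [← hqq, ← mul_assoc]
    exact mul_le_mul_of_nonneg_right hr hq.le
  have hs0 : 0 < b * q := by positivity
  have ht : 0 < t := by nlinarith
  have htk : t ≤ k := by nlinarith
  set j := Nat.sqrt k with hj
  have hj1 : (j : ℝ) ≤ q := Real.nat_sqrt_le_real_sqrt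
  have hj2 : q ≤ j + 1 := Real.real_sqrt_le_nat_sqrt_succ
  have hjk : (j : ℝ) ≤ k := by exact_mod_cast Nat.sqrt_le_self k
  have hn : k + j ≠ 0 := by omega
  have hncast : ((k + j : ℕ) : ℝ) = k + j := by push_cast; rfl
  have hw := le_poissonWeight ht hn
  rw [hncast] at hw
  set n : ℝ := (k : ℝ) + j with hndef
  have hkn : (k : ℝ) ≤ n := by simp [hndef]
  have hn0 : 0 < n := hk0.trans_le hkn
  set d := n - t with hd
  have hd0 : 0 ≤ d := by linarith
  have hds : d ≤ (1 - ε / 2) * (b * q) := by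
    have : 2 * q ≤ ε * b * q := mul_le_mul_of_nonneg_right hb hq.le
    have : d = (1 - ε) * (b * q) + j := by rw [hd, htdef, hndef]; ring
    linarith
  set x := d / n with hx
  have hx0 : 0 ≤ x := div_nonneg hd0 hn0.le
  have hx1 : x ≤ ε / 8 := by
    rw [hx, div_le_iff₀ hn0]
    nlinarith
  have hxt : t / n = 1 - x := by
    rw [hx, hd]
    field_simp
    ring
  have hnx : n * x ^ 2 ≤ (1 - ε / 2) ^ 2 * b ^ 2 := by
    have h1 : n * x ^ 2 = d ^ 2 / n := by rw [hx]; field_simp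
    rw [h1, div_le_iff₀ hn0]
    calc d ^ 2 ≤ ((1 - ε / 2) * (b * q)) ^ 2 := pow_le_pow_left₀ hd0 hds 2
      _ = (1 - ε / 2) ^ 2 * b ^ 2 * k := by rw [← hqq]; ring
      _ ≤ _ := by gcongr
  have hexp : -((1 / 2 - ε / 4) * b ^ 2) ≤ d + n * Real.log (t / n) := by
    have hl := mul_le_mul_of_nonneg_left (le_log_one_sub hx0 (by linarith)) hn0.le
    rw [hxt]
    have hnd : n * x = d := by rw [hx]; field_simp
    have h2 : n * x ^ 2 * (1 / 2 + 2 * x) ≤ (1 - ε / 2) ^ 2 * b ^ 2 * (1 / 2 + ε / 4) := by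
      gcongr
      linarith
    have h3 : (1 - ε / 2) ^ 2 * b ^ 2 * (1 / 2 + ε / 4) ≤ (1 / 2 - ε / 4) * b ^ 2 := by
      have : 0 ≤ (1 / 2 - ε / 4) * b ^ 2 * (ε ^ 2 / 4) :=
        mul_nonneg (mul_nonneg (by linarith) (sq_nonneg b)) (by positivity)
      linarith
    linarith
  have hsq : √n ≤ √2 * q := by
    rw [hqdef, ← Real.sqrt_mul (by norm_num)]
    exact Real.sqrt_le_sqrt (by linarith)
  have he : Real.exp 1 * √2 ≤ 4 := by
    have h1 := Real.exp_one_lt_d9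
    have h2 : √2 ≤ 1.42 := Real.sqrt_le_iff.2 (by norm_num)
    nlinarith [Real.exp_pos 1, Real.sqrt_nonneg 2]
  have hden : Real.exp 1 * √n ≤ 4 * q :=
    calc Real.exp 1 * √n ≤ Real.exp 1 * (√2 * q) := by gcongr
      _ = Real.exp 1 * √2 * q := by ring
      _ ≤ 4 * q := by gcongr
  refine le_trans ?_ (succ_mul_poissonWeight_le_poissonTail ht htk j)
  calc Real.exp (-((1 / 2 - ε / 4) * b ^ 2)) / 4
      = q * (Real.exp (-((1 / 2 - ε / 4) * b ^ 2)) / (4 * q)) := by field_simp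
    _ ≤ (j + 1) * (Real.exp (d + n * Real.log (t / n)) / (Real.exp 1 * √n)) := by
        gcongr ?_ * (Real.exp ?_ / ?_)
    _ ≤ _ := by gcongr

lemma abs_poissonTail_div_sub_one_le_of_balance {ε : ℝ} (hε : 0 < ε) (hε1 : ε < 1) {k : ℕ}
    (hk : k ≠ 0) {t : ℝ} (ht : 0 < t)
    (hbal : k * poissonTail t k = (k - t) * (1 - poissonTail t k) + k * poissonWeight t k)
    (hb : 2 ≤ ε * √(Real.log k)) (hr : √(Real.log k) ≤ ε / 8 * √k)
    (hexp : 4 * √(Real.log k) < Real.exp (ε / 4 * Real.log k)) :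
    |poissonTail t k / √(Real.log k / k) - 1| ≤ 2 * ε := by
  have hk0 : (0 : ℝ) < k := by positivity
  have hq : 0 < √(k : ℝ) := by positivity
  have hqq : √(k : ℝ) * √k = k := Real.mul_self_sqrt hk0.le
  have hlog : 0 ≤ Real.log k := Real.log_natCast_nonneg k
  have hlow := exp_div_four_le_poissonTail hε hε1 hk hb hr
  rw [Real.sqrt_div hlog]
  have hbb : √(Real.log k) ^ 2 = Real.log k := Real.sq_sqrt hlog
  have hkexp : Real.exp (-(Real.log k / 2)) = 1 / √k := by
    rw [Real.exp_neg, ← Real.log_sqrt hk0.le, Real.exp_log hq, one_div]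
  rw [← hbb] at hkexp
  replace hexp : 4 * √(Real.log k) < Real.exp (ε / 4 * √(Real.log k) ^ 2) := by rwa [hbb]
  have hb2 : 2 ≤ √(Real.log k) := by nlinarith [Real.sqrt_nonneg (Real.log k)]
  have hp : k * poissonWeight t k ≤ √k := by
    refine (mul_le_mul_of_nonneg_left (poissonWeight_le_inv_sqrt ht hk) hk0.le).trans_eq ?_
    rw [mul_one_div, Real.div_sqrt]
  have hp0 : 0 < k * poissonWeight t k := mul_pos hk0 (poissonWeight_pos ht k)
  have hQ0 := poissonTail_nonneg ht k
  have hQ1 := poissonTail_le_one ht k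
  have hmono := fun h h' => poissonTail_mono (s := k - (1 - ε) * (√(Real.log k) * √k)) (t := t)
    h h' k
  have hchern := poissonTail_le_exp ht hk
  generalize √(Real.log k) = b at *
  generalize √(k : ℝ) = q at *
  set Q := poissonTail t k
  have hsk : b * q ≤ ε / 8 * k := by
    rw [← hqq, ← mul_assoc]
    exact mul_le_mul_of_nonneg_right hr hq.le
  have hs0 : 0 < b * q := by positivity
  have hqs : q ≤ ε / 2 * (b * q) := by nlinarith
  have hupper : k - t ≤ b * q := by
    by_contra! h
    have h1 : Q ≤ 1 / q := by
      refine (hchern (by linarith)).trans ?_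
      rw [← hkexp, Real.exp_le_exp, neg_le_neg_iff, div_le_div_iff₀ (by norm_num) (by positivity)]
      have : (b * q) ^ 2 ≤ (k - t) ^ 2 := pow_le_pow_left₀ hs0.le h.le 2
      rw [mul_pow, sq q, hqq] at this
      linarith
    have h2 : k * Q ≤ q := by
      rw [← hqq, mul_assoc]
      refine mul_le_of_le_one_right hq.le ?_
      rwa [le_div_iff₀' hq] at h1
    have h3 : Q ≤ 1 / 4 := by
      nlinarith
    nlinarith
  have hlower : (1 - ε) * (b * q) ≤ k - t := by
    by_contra! h
    have h1 := hlow.trans (hmono (by nlinarith) (by linarith))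
    have h2 : k * Q ≤ b * q := by
      have hd : (k - t) * (1 - Q) ≤ (1 - ε) * (b * q) * (1 - Q) :=
        mul_le_mul_of_nonneg_right h.le (by linarith)
      have hd' : (1 - ε) * (b * q) * (1 - Q) ≤ (1 - ε) * (b * q) :=
        mul_le_of_le_one_right (mul_nonneg (by linarith) hs0.le) (by linarith)
      linarith
    have h3 : q * Q ≤ b := by
      rw [← hqq] at h2
      nlinarith
    have h4 : Real.exp (-((1 / 2 - ε / 4) * b ^ 2)) = Real.exp (ε / 4 * b ^ 2) * (1 / q) := by
      rw [← hkexp, ← Real.exp_add]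
      ring_nf
    rw [h4, mul_one_div, div_div, div_le_iff₀ (by positivity)] at h1
    linarith
  have hkQ : k * Q ≤ (1 + ε / 2) * (b * q) := by nlinarith
  have hQs : Q ≤ ε / 4 := by nlinarith
  have hkQ' : (1 - 2 * ε) * (b * q) ≤ k * Q := by
    have h1 : (1 - ε) * (b * q) * (1 - Q) ≤ (k - t) * (1 - Q) :=
      mul_le_mul_of_nonneg_right hlower (by linarith)
    have h2 : (1 - ε) * (b * q) * (1 - ε / 4) ≤ (1 - ε) * (b * q) * (1 - Q) := by
      refine mul_le_mul_of_nonneg_left (by linarith) ?_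
      exact mul_nonneg (by linarith) hs0.le
    nlinarith [mul_pos hε hs0, mul_pos (mul_pos hε hε) hs0]
  have hdiv : Q / (b / q) = k * Q / (b * q) := by
    rw [← hqq]
    field_simp
  rw [hdiv, abs_le]
  constructor
  · have := (le_div_iff₀ hs0).2 hkQ'
    linarith
  · have := (div_le_iff₀ hs0).2 hkQ
    linarith

open Real Filter Finset

/-- If for each `k ≥ 1`, `λ_k > 0` satisfies the balance equation
`E[min(X_k, k)]/k = Pr(X_k ≤ k−1)` for `X_k ~ Poisson(λ_k)`, then
`Pr(X_k ≤ k−1) = 1 − √(log k / k) + o(√(log k / k))`; equivalently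
`(1 − Pr(X_k ≤ k−1))/√(log k / k) → 1` as `k → ∞`. -/
theorem poisson_balance_ratio_asymptotics (lam : ℕ → ℝ)
    (hpos : ∀ k : ℕ, 1 ≤ k → 0 < lam k)
    (hbal : ∀ k : ℕ, 1 ≤ k →
      (∑' m : ℕ, (↑(min m k) : ℝ) * (Real.exp (-(lam k)) * lam k ^ m / m.factorial)) / k
        = ∑ m ∈ Finset.range k, Real.exp (-(lam k)) * lam k ^ m / m.factorial) :
    Tendsto
      (fun k : ℕ =>
        (1 - ∑ m ∈ Finset.range k, Real.exp (-(lam k)) * lam k ^ m / m.factorial)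
          / Real.sqrt (Real.log k / k))
      atTop (nhds 1) := by
  rw [Metric.tendsto_atTop']
  intro δ hδ
  obtain ⟨ε, hε, hε1, hεδ⟩ : ∃ ε : ℝ, 0 < ε ∧ ε < 1 ∧ 2 * ε < δ :=
    ⟨min (1 / 2) (δ / 4), by positivity, by linarith [min_le_left (1 / 2) (δ / 4)],
      by linarith [min_le_right (1 / 2) (δ / 4)]⟩
  have hcast : Tendsto (fun k : ℕ => (k : ℝ)) atTop atTop := tendsto_natCast_atTop_atTop
  have hlog : Tendsto (fun k : ℕ => Real.log k) atTop atTop := Real.tendsto_log_atTop.comp hcast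
  have hsqrt : Tendsto (fun k : ℕ => √(Real.log k)) atTop atTop :=
    Real.tendsto_sqrt_atTop.comp hlog
  have h1 : ∀ᶠ k : ℕ in atTop, 2 ≤ ε * √(Real.log k) :=
    (hsqrt.const_mul_atTop hε).eventually_ge_atTop 2
  have h2 : ∀ᶠ k : ℕ in atTop, √(Real.log k) ≤ ε / 8 * √k := by
    have h := Real.isLittleO_log_id_atTop.bound (show 0 < (ε / 8) ^ 2 by positivity)
    filter_upwards [hcast.eventually h] with k hk
    rw [← Real.sqrt_sq (show 0 ≤ ε / 8 by positivity), ← Real.sqrt_mul (sq_nonneg _)]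
    refine Real.sqrt_le_sqrt ((le_abs_self _).trans ?_)
    simpa using hk
  have h3 : ∀ᶠ k : ℕ in atTop, 4 * √(Real.log k) < Real.exp (ε / 4 * Real.log k) := by
    have h := (isLittleO_pow_exp_pos_mul_atTop 1 (show 0 < ε / 4 by positivity)).bound
      (show (0 : ℝ) < 1 / 5 by norm_num)
    filter_upwards [hlog.eventually h, hlog.eventually_ge_atTop 1] with k hk hk1
    have hs : √(Real.log k) ≤ Real.log k := Real.sqrt_le_self_iff.2 (Or.inr hk1)
    have he := Real.exp_pos (ε / 4 * Real.log k)
    rw [pow_one, Real.norm_of_nonneg (by linarith), Real.norm_of_nonneg he.le] at hk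
    linarith
  obtain ⟨N, hN⟩ := eventually_atTop.1 (h1.and (h2.and h3))
  refine ⟨N, fun k hkN => ?_⟩
  obtain ⟨g1, g2, g3⟩ := hN k hkN.le
  have hk : 1 ≤ k := by omega
  rw [Real.dist_eq]
  exact (abs_poissonTail_div_sub_one_le_of_balance hε hε1 (by omega) (hpos k hk)
    (mul_poissonTail_eq_of_balance hk (hbal k hk)) g1 g2 g3).trans_lt hεδ
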